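/- Let A = R/I be a narrow artinian quotient of R = k[x_1,...,x_n] with s(A) = d and dim_k (I^⊥)_{-d} = a. Then the socle polynomial of A equals b·z^{d-1} + a·z^d where b = dim_k R_{d-1} − dim_k(R_1 ∘ (I^⊥)_{-d}), and dim_k R_{d-1} > b ≥ dim_k R_{d-1} − a·n. -/

import Mathlib

open MvPolynomial

noncomputable section
namespace PSI

open scoped Classical

variable (k : Type) [Field k] (n : ℕ)

/-- The contraction action of `R = k[x_1,…,x_n]` on its graded dual `S`, where `S` is
modeled by polynomials in the dual variables `y_i` (dual basis to the monomial basis);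
on basis elements, `x^d ∘ y^(e) = y^(e-d)` if `d ≤ e` componentwise and `0` otherwise. -/
def contract (f g : MvPolynomial (Fin n) k) : MvPolynomial (Fin n) k :=
  ∑ d ∈ f.support, f.coeff d • g.divMonomial d

theorem divMonomial_add (a b : MvPolynomial (Fin n) k) (s : Fin n →₀ ℕ) :
    (a + b).divMonomial s = a.divMonomial s + b.divMonomial s := by
  ext c; simp [MvPolynomial.coeff_divMonomial]

theorem divMonomial_smul (r : k) (a : MvPolynomial (Fin n) k) (s : Fin n →₀ ℕ) :
    (r • a).divMonomial s = r • a.divMonomial s := by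
  ext c; simp [MvPolynomial.coeff_divMonomial]

theorem divMonomial_zero (s : Fin n →₀ ℕ) :
    (0 : MvPolynomial (Fin n) k).divMonomial s = 0 := by
  ext c; simp [MvPolynomial.coeff_divMonomial]

theorem contract_add_right (f a b : MvPolynomial (Fin n) k) :
    contract k n f (a + b) = contract k n f a + contract k n f b := by
  simp [contract, divMonomial_add, smul_add, Finset.sum_add_distrib]

theorem contract_smul_right (f : MvPolynomial (Fin n) k) (r : k) (a : MvPolynomial (Fin n) k) :
    contract k n f (r • a) = r • contract k n f a := by
  simp only [contract, divMonomial_smul]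
  rw [Finset.smul_sum]
  exact Finset.sum_congr rfl fun d _ => smul_comm _ _ _

theorem contract_zero_right (f : MvPolynomial (Fin n) k) : contract k n f 0 = 0 := by
  simp [contract, divMonomial_zero]

/-- The degree `-d` graded piece of the Macaulay inverse system `I^⊥ ⊆ S`:
homogeneous dual polynomials of degree `d` annihilated by `I` under contraction. -/
def perpSub (I : Ideal (MvPolynomial (Fin n) k)) (d : ℕ) :
    Submodule k (MvPolynomial (Fin n) k) where
  carrier := {g | g ∈ homogeneousSubmodule (Fin n) k d ∧ ∀ f ∈ I, contract k n f g = 0}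
  add_mem' := by
    rintro a b ⟨ha1, ha2⟩ ⟨hb1, hb2⟩
    exact ⟨Submodule.add_mem _ ha1 hb1, fun f hf => by
      rw [contract_add_right, ha2 f hf, hb2 f hf, add_zero]⟩
  zero_mem' := ⟨Submodule.zero_mem _, fun f _ => contract_zero_right k n f⟩
  smul_mem' := by
    rintro c a ⟨ha1, ha2⟩
    exact ⟨Submodule.smul_mem _ c ha1, fun f hf => by
      rw [contract_smul_right, ha2 f hf, smul_zero]⟩

/-- The full Macaulay inverse system `I^⊥` as a subset of `S`. -/
def perpSet (I : Ideal (MvPolynomial (Fin n) k)) : Set (MvPolynomial (Fin n) k) :=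
  {g | ∀ f ∈ I, contract k n f g = 0}



/-- The degree `m` graded piece of `A = R/I`, as a `k`-subspace of the quotient. -/
def Agr (I : Ideal (MvPolynomial (Fin n) k)) (m : ℕ) :
    Submodule k (MvPolynomial (Fin n) k ⧸ I) :=
  (homogeneousSubmodule (Fin n) k m).map (Ideal.Quotient.mkₐ k I).toLinearMap

/-- The socle of `A = R/I`: elements annihilated by all the variables. -/
def socSub (I : Ideal (MvPolynomial (Fin n) k)) :
    Submodule k (MvPolynomial (Fin n) k ⧸ I) :=
  ⨅ j : Fin n, LinearMap.ker (LinearMap.mulLeft k (Ideal.Quotient.mk I (X j)))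

/-- `dim_k Soc(A)_j`. -/
def socdim (I : Ideal (MvPolynomial (Fin n) k)) (j : ℕ) : ℕ :=
  Module.finrank k ↥(Agr k n I j ⊓ socSub k n I)

/-- Hilbert function of `A = R/I`. -/
def hfA (I : Ideal (MvPolynomial (Fin n) k)) (i : ℕ) : ℕ :=
  Module.finrank k ↥(Agr k n I i)

/-- `dim_k R_i`. -/
def rdim (i : ℕ) : ℕ := Module.finrank k ↥(homogeneousSubmodule (Fin n) k i)

/-- The degree `i` graded piece of a homogeneous ideal `I`. -/
def Igrade (I : Ideal (MvPolynomial (Fin n) k)) (i : ℕ) :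
    Submodule k (MvPolynomial (Fin n) k) :=
  homogeneousSubmodule (Fin n) k i ⊓ Submodule.restrictScalars k I

/-- The initial degree `t(I)` of a homogeneous ideal. -/
def tdeg (I : Ideal (MvPolynomial (Fin n) k)) : ℕ := sInf {i | Igrade k n I i ≠ ⊥}

/-- The top socle degree `s(A)` of `A = R/I`. -/
def sdeg (I : Ideal (MvPolynomial (Fin n) k)) : ℕ :=
  sSup {i | Agr k n I i ⊓ socSub k n I ≠ ⊥}

/-- `I` is a homogeneous ideal. -/
def IsHomog (I : Ideal (MvPolynomial (Fin n) k)) : Prop :=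
  ∀ f ∈ I, ∀ m : ℕ, homogeneousComponent m f ∈ I

/-- `A = R/I` is a narrow algebra: an artinian graded quotient with `t(I) ≥ s(A)`. -/
def IsNarrow (I : Ideal (MvPolynomial (Fin n) k)) : Prop :=
  IsHomog k n I ∧ IsArtinianRing (MvPolynomial (Fin n) k ⧸ I) ∧ sdeg k n I ≤ tdeg k n I

/-- The homogeneous maximal ideal `m = (x_1,…,x_n)`. -/
def mIdeal : Ideal (MvPolynomial (Fin n) k) := Ideal.span (Set.range X)


/-- The `k`-bilinear form on polynomials for which the monomials are orthonormal. -/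
def pairing : LinearMap.BilinForm k (MvPolynomial (Fin n) k) :=
  (basisMonomials (Fin n) k).constr k fun e => lcoeff k e

variable {k n}

theorem pairing_monomial (e : Fin n →₀ ℕ) (c : k) (g : MvPolynomial (Fin n) k) :
    pairing k n (monomial e c) g = c * coeff e g := by
  have h : monomial e c = c • basisMonomials (Fin n) k e := by simp [smul_monomial]
  rw [h, map_smul, pairing, Module.Basis.constr_basis]
  simp

theorem pairing_comm (f g : MvPolynomial (Fin n) k) :
    pairing k n f g = pairing k n g f := by
  induction f using MvPolynomial.induction_on' with
  | add p q hp hq => simp [hp, hq]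
  | monomial e c =>
    induction g using MvPolynomial.induction_on' with
    | add p q hp hq => simp [← hp, ← hq]
    | monomial e' c' =>
      simp only [pairing_monomial, coeff_monomial]
      by_cases h : e = e'
      · simp [h, mul_comm]
      · simp [h, Ne.symm h]

theorem pairing_mul (p q g : MvPolynomial (Fin n) k) :
    pairing k n (p * q) g = pairing k n q (contract k n p g) := by
  have key (d : Fin n →₀ ℕ) (c : k) :
      pairing k n (monomial d c * q) g = pairing k n q (c • g.divMonomial d) := by
    induction q using MvPolynomial.induction_on' with
    | add p q hp hq => rw [mul_add, map_add, map_add, LinearMap.add_apply, hp, hq]; rfl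
    | monomial e c' =>
      simp [monomial_mul, pairing_monomial, coeff_divMonomial]
      ring
  conv_lhs => rw [p.as_sum]
  simp only [Finset.sum_mul, map_sum, LinearMap.sum_apply, key, contract]

theorem coeff_contract (f g : MvPolynomial (Fin n) k) (c : Fin n →₀ ℕ) :
    coeff c (contract k n f g) = pairing k n (f * monomial c 1) g := by
  rw [pairing_mul, pairing_monomial, one_mul]

theorem contract_add_left (f f' g : MvPolynomial (Fin n) k) :
    contract k n (f + f') g = contract k n f g + contract k n f' g := by
  ext c; simp [coeff_contract, add_mul]

theorem contract_smul_left (r : k) (f g : MvPolynomial (Fin n) k) :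
    contract k n (r • f) g = r • contract k n f g := by
  ext c; simp [coeff_contract]

theorem contract_zero_left (g : MvPolynomial (Fin n) k) : contract k n 0 g = 0 := by
  ext c; simp [coeff_contract]

theorem pairing_eq_zero_of_ne {f g : MvPolynomial (Fin n) k} {i j : ℕ}
    (hf : f.IsHomogeneous i) (hg : g.IsHomogeneous j) (hij : i ≠ j) : pairing k n f g = 0 := by
  rw [f.as_sum, map_sum, LinearMap.sum_apply]
  refine Finset.sum_eq_zero fun e _ => ?_
  rw [pairing_monomial]
  by_cases he : e.degree = i
  · rw [hg.coeff_eq_zero (he.trans_ne hij), mul_zero]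
  · rw [hf.coeff_eq_zero he, zero_mul]

theorem pairing_homogeneousComponent {f g : MvPolynomial (Fin n) k} {d : ℕ}
    (hg : g.IsHomogeneous d) :
    pairing k n (homogeneousComponent d f) g = pairing k n f g := by
  conv_rhs => rw [← sum_homogeneousComponent f, map_sum, LinearMap.sum_apply]
  by_cases hd : d ∈ Finset.range (f.totalDegree + 1)
  · rw [Finset.sum_eq_single_of_mem d hd]
    exact fun i _ hi => pairing_eq_zero_of_ne (homogeneousComponent_isHomogeneous i f) hg hi
  · rw [homogeneousComponent_eq_zero _ _ (by simpa using hd), map_zero, LinearMap.zero_apply]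
    refine (Finset.sum_eq_zero fun i hi => ?_).symm
    exact pairing_eq_zero_of_ne (homogeneousComponent_isHomogeneous i f) hg
      (ne_of_mem_of_not_mem hi hd)

theorem contract_isHomogeneous {f g : MvPolynomial (Fin n) k} {i j : ℕ}
    (hf : f.IsHomogeneous i) (hg : g.IsHomogeneous (i + j)) :
    (contract k n f g).IsHomogeneous j := by
  intro c hc
  change Finsupp.weight (fun _ => 1) c = j
  rw [← Finsupp.degree_eq_weight_one]
  by_contra h
  refine hc ?_
  rw [coeff_contract]
  refine pairing_eq_zero_of_ne (hf.mul (isHomogeneous_monomial 1 rfl)) hg fun h' => h ?_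
  exact Nat.add_left_cancel h'

instance homogeneousSubmodule_finite (d : ℕ) :
    Module.Finite k (homogeneousSubmodule (Fin n) k d) :=
  Module.Finite.iff_fg.2 (homogeneousSubmodule_fg _ _ d)

theorem finite_of_le_homogeneousSubmodule {W : Submodule k (MvPolynomial (Fin n) k)} {d : ℕ}
    (hW : W ≤ homogeneousSubmodule (Fin n) k d) : Module.Finite k W :=
  Submodule.finiteDimensional_of_le hW

theorem pairing_restrict_isRefl (d : ℕ) :
    ((pairing k n).restrict (homogeneousSubmodule (Fin n) k d)).IsRefl :=
  fun x y h => (pairing_comm (y : MvPolynomial (Fin n) k) x).trans h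

theorem pairing_restrict_nondegenerate (d : ℕ) :
    ((pairing k n).restrict (homogeneousSubmodule (Fin n) k d)).Nondegenerate := by
  have h : ∀ x : homogeneousSubmodule (Fin n) k d,
      (∀ y : homogeneousSubmodule (Fin n) k d, pairing k n y x = 0) → x = 0 := by
    rintro ⟨x, hx⟩ h
    ext e
    by_cases he : e.degree = d
    · simpa [pairing_monomial] using h ⟨monomial e 1, isHomogeneous_monomial 1 he⟩
    · simpa using IsHomogeneous.coeff_eq_zero hx he
  exact ⟨fun x hx => h x fun y => (pairing_comm _ _).trans (hx y), fun x hx => h x hx⟩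

section Orthogonal

variable {d : ℕ} {U W : Submodule k (MvPolynomial (Fin n) k)}

theorem orthogonal_comap_subtype (hW : W ≤ homogeneousSubmodule (Fin n) k d)
    (h : ∀ g ∈ homogeneousSubmodule (Fin n) k d, g ∈ U ↔ ∀ f ∈ W, pairing k n f g = 0) :
    ((pairing k n).restrict (homogeneousSubmodule (Fin n) k d)).orthogonal
      (W.comap (homogeneousSubmodule (Fin n) k d).subtype) =
    U.comap (homogeneousSubmodule (Fin n) k d).subtype := by
  ext ⟨g, hg⟩
  rw [LinearMap.BilinForm.mem_orthogonal_iff, Submodule.mem_comap, Submodule.subtype_apply, h g hg]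
  exact ⟨fun H f hf => H ⟨f, hW hf⟩ hf, fun H f hf => H f hf⟩

theorem finrank_add_finrank_of_orthogonal (hW : W ≤ homogeneousSubmodule (Fin n) k d)
    (hU : U ≤ homogeneousSubmodule (Fin n) k d)
    (h : ∀ g ∈ homogeneousSubmodule (Fin n) k d, g ∈ U ↔ ∀ f ∈ W, pairing k n f g = 0) :
    Module.finrank k U + Module.finrank k W = rdim k n d := by
  rw [← (Submodule.comapSubtypeEquivOfLe hU).finrank_eq,
    ← (Submodule.comapSubtypeEquivOfLe hW).finrank_eq, ← orthogonal_comap_subtype hW h,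
    LinearMap.BilinForm.finrank_orthogonal (pairing_restrict_nondegenerate d)]
  exact Nat.sub_add_cancel (Submodule.finrank_le _)

theorem mem_of_orthogonal (hW : W ≤ homogeneousSubmodule (Fin n) k d)
    (h : ∀ g ∈ homogeneousSubmodule (Fin n) k d, g ∈ U ↔ ∀ f ∈ W, pairing k n f g = 0)
    {f : MvPolynomial (Fin n) k} (hf : f ∈ homogeneousSubmodule (Fin n) k d)
    (hfU : ∀ g ∈ U, pairing k n f g = 0) : f ∈ W := by
  have key : (⟨f, hf⟩ : homogeneousSubmodule (Fin n) k d) ∈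
      W.comap (homogeneousSubmodule (Fin n) k d).subtype := by
    rw [← LinearMap.BilinForm.orthogonal_orthogonal (pairing_restrict_nondegenerate d)
      (pairing_restrict_isRefl d) (W.comap _), orthogonal_comap_subtype hW h]
    exact fun g hg => (pairing_comm _ _).trans (hfU g hg)
  exact key

end Orthogonal

section Ideal

variable {I : Ideal (MvPolynomial (Fin n) k)}

theorem perpSub_le (d : ℕ) : perpSub k n I d ≤ homogeneousSubmodule (Fin n) k d :=
  fun _ hg => hg.1

theorem pairing_eq_zero_of_mem_perpSub {d : ℕ} {f g : MvPolynomial (Fin n) k} (hf : f ∈ I)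
    (hg : g ∈ perpSub k n I d) : pairing k n f g = 0 := by
  simpa [hg.2 f hf] using (coeff_contract f g 0).symm

theorem mem_perpSub_iff_pairing (hI : IsHomog k n I) (d : ℕ) (g : MvPolynomial (Fin n) k)
    (hg : g ∈ homogeneousSubmodule (Fin n) k d) :
    g ∈ perpSub k n I d ↔ ∀ f ∈ Igrade k n I d, pairing k n f g = 0 := by
  refine ⟨fun h f hf => pairing_eq_zero_of_mem_perpSub hf.2 h, fun h => ⟨hg, fun f hf => ?_⟩⟩
  ext c
  rw [coeff_contract, coeff_zero, ← pairing_homogeneousComponent hg]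
  exact h _ ⟨homogeneousComponent_isHomogeneous _ _, hI _ (I.mul_mem_right _ hf) d⟩

theorem finrank_map_mk_add_finrank_inf {d : ℕ} {W : Submodule k (MvPolynomial (Fin n) k)}
    (hW : W ≤ homogeneousSubmodule (Fin n) k d) :
    Module.finrank k (W.map (Ideal.Quotient.mkₐ k I).toLinearMap) +
      Module.finrank k ↥(W ⊓ I.restrictScalars k) = Module.finrank k W := by
  have := finite_of_le_homogeneousSubmodule hW
  have h := LinearMap.finrank_range_add_finrank_ker
    ((Ideal.Quotient.mkₐ k I).toLinearMap.domRestrict W)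
  have hker : LinearMap.ker ((Ideal.Quotient.mkₐ k I).toLinearMap.domRestrict W) =
      (W ⊓ I.restrictScalars k).comap W.subtype := by
    ext x
    simp [Ideal.Quotient.eq_zero_iff_mem]
  rwa [LinearMap.range_domRestrict, hker,
    (Submodule.comapSubtypeEquivOfLe inf_le_left).finrank_eq] at h

theorem mk_mem_socSub_iff (f : MvPolynomial (Fin n) k) :
    Ideal.Quotient.mk I f ∈ socSub k n I ↔ ∀ i, X i * f ∈ I := by
  simp [socSub, ← map_mul, Ideal.Quotient.eq_zero_iff_mem]

variable (k n I) in
/-- The forms of degree `j` whose class in `R/I` lies in the socle. -/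
def socLift (j : ℕ) : Submodule k (MvPolynomial (Fin n) k) :=
  homogeneousSubmodule (Fin n) k j ⊓
    (socSub k n I).comap (Ideal.Quotient.mkₐ k I).toLinearMap

theorem mem_socLift_iff {j : ℕ} {f : MvPolynomial (Fin n) k} :
    f ∈ socLift k n I j ↔ f ∈ homogeneousSubmodule (Fin n) k j ∧ ∀ i, X i * f ∈ I :=
  and_congr_right fun _ => mk_mem_socSub_iff f

theorem map_socLift (j : ℕ) :
    (socLift k n I j).map (Ideal.Quotient.mkₐ k I).toLinearMap =
      Agr k n I j ⊓ socSub k n I :=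
  Submodule.map_inf_eq_map_inf_comap.symm

theorem Agr_eq_bot_iff {j : ℕ} :
    Agr k n I j = ⊥ ↔ ∀ f ∈ homogeneousSubmodule (Fin n) k j, f ∈ I := by
  rw [Agr, ← LinearMap.le_ker_iff_map]
  simp [SetLike.le_def, Ideal.Quotient.eq_zero_iff_mem]

theorem Agr_le_socSub {j : ℕ} (h : Agr k n I (j + 1) = ⊥) : Agr k n I j ≤ socSub k n I := by
  rintro _ ⟨f, hf, rfl⟩
  refine (mk_mem_socSub_iff f).2 fun i => Agr_eq_bot_iff.1 h _ ?_
  rw [add_comm]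
  exact (isHomogeneous_X k i).mul hf

theorem exists_Agr_eq_bot (hI : IsHomog k n I) [IsArtinianRing (MvPolynomial (Fin n) k ⧸ I)] :
    ∃ N, ∀ m, N ≤ m → Agr k n I m = ⊥ := by
  have hanti : Antitone fun m => ((idealOfVars (Fin n) k) ^ m).map (Ideal.Quotient.mk I) :=
    fun a b hab => Ideal.map_mono (Ideal.pow_le_pow_right hab)
  obtain ⟨N, hN⟩ := IsArtinian.monotone_stabilizes
    (⟨fun m => OrderDual.toDual (((idealOfVars (Fin n) k) ^ m).map (Ideal.Quotient.mk I)),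
      hanti⟩ : ℕ →o (Ideal (MvPolynomial (Fin n) k ⧸ I))ᵒᵈ)
  refine ⟨N, fun m hm => Agr_eq_bot_iff.2 fun f hf => ?_⟩
  have h1 : ((idealOfVars (Fin n) k) ^ m).map (Ideal.Quotient.mk I) =
      ((idealOfVars (Fin n) k) ^ (m + 1)).map (Ideal.Quotient.mk I) :=
    (hN m hm).symm.trans (hN (m + 1) (hm.trans m.le_succ))
  have hfm : f ∈ (idealOfVars (Fin n) k) ^ m := by
    rw [mem_pow_idealOfVars_iff]
    intro e he
    exact (not_imp_comm.1 (IsHomogeneous.coeff_eq_zero hf) (mem_support_iff.1 he)).ge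
  have h2 := h1 ▸ Ideal.mem_map_of_mem (Ideal.Quotient.mk I) hfm
  obtain ⟨g, hg, hgf⟩ := (Ideal.mem_map_iff_of_surjective _ Ideal.Quotient.mk_surjective).1 h2
  have h3 := hI _ (Ideal.Quotient.eq.1 hgf.symm) m
  have hg0 : homogeneousComponent m g = 0 := by
    refine homogeneousComponent_eq_zero' _ _ fun e he => ?_
    have := (mem_pow_idealOfVars_iff _ _).1 hg e he
    lia
  rwa [map_sub, hg0, sub_zero, homogeneousComponent_eq_self hf] at h3

theorem Agr_eq_bot_of_sdeg_lt (hI : IsHomog k n I)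
    [IsArtinianRing (MvPolynomial (Fin n) k ⧸ I)] {m : ℕ} (hm : sdeg k n I < m) :
    Agr k n I m = ⊥ := by
  obtain ⟨N, hN⟩ := exists_Agr_eq_bot hI
  have hbdd : BddAbove {i | Agr k n I i ⊓ socSub k n I ≠ ⊥} := by
    refine ⟨N, fun i hi => ?_⟩
    by_contra! h
    exact hi (by rw [hN i h.le, bot_inf_eq])
  by_contra hne
  have hmN : m ≤ N := by
    by_contra! h
    exact hne (hN m h.le)
  refine hne (Nat.decreasingInduction' (P := fun i => Agr k n I i = ⊥) (fun j _ hj ih => ?_) hmN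
    (hN N le_rfl))
  by_contra hj'
  refine (hm.trans_le hj).not_ge (le_csSup hbdd ?_)
  rwa [Set.mem_ofPred_eq, inf_eq_left.2 (Agr_le_socSub ih)]

theorem Igrade_eq_bot_of_lt_tdeg {i : ℕ} (hi : i < tdeg k n I) : Igrade k n I i = ⊥ :=
  not_not.1 (Nat.notMem_of_lt_sInf hi)

theorem finrank_Agr_add_finrank_Igrade (d : ℕ) :
    Module.finrank k (Agr k n I d) + Module.finrank k (Igrade k n I d) = rdim k n d :=
  finrank_map_mk_add_finrank_inf le_rfl

theorem finrank_Agr_eq_finrank_perpSub (hI : IsHomog k n I) (d : ℕ) :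
    Module.finrank k (Agr k n I d) = Module.finrank k (perpSub k n I d) :=
  Nat.add_right_cancel ((finrank_Agr_add_finrank_Igrade d).trans
    (finrank_add_finrank_of_orthogonal inf_le_left (perpSub_le d)
      (mem_perpSub_iff_pairing hI d)).symm)

theorem socdim_eq_finrank_socLift {j : ℕ} (h : Igrade k n I j = ⊥) :
    socdim k n I j = Module.finrank k (socLift k n I j) := by
  have hbot : socLift k n I j ⊓ I.restrictScalars k = ⊥ :=
    le_bot_iff.1 (h ▸ inf_le_inf_right _ inf_le_left)
  rw [← finrank_map_mk_add_finrank_inf (W := socLift k n I j) (I := I) inf_le_left, hbot,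
    finrank_bot, add_zero, map_socLift, socdim]

variable (k n I) in
/-- The space `R_1 ∘ (I^⊥)_{-d}` of contractions of `(I^⊥)_{-d}` by linear forms. -/
def contractPerp (d : ℕ) : Submodule k (MvPolynomial (Fin n) k) :=
  Submodule.span k {g | ∃ ℓ ∈ homogeneousSubmodule (Fin n) k 1,
    ∃ G ∈ perpSub k n I d, g = contract k n ℓ G}

theorem contractPerp_le (d : ℕ) :
    contractPerp k n I (d + 1) ≤ homogeneousSubmodule (Fin n) k d := by
  refine Submodule.span_le.2 ?_
  rintro _ ⟨ℓ, hℓ, G, hG, rfl⟩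
  exact contract_isHomogeneous hℓ (add_comm d 1 ▸ perpSub_le _ hG)

theorem mem_socLift_iff_pairing (hI : IsHomog k n I) (d : ℕ) (f : MvPolynomial (Fin n) k)
    (hf : f ∈ homogeneousSubmodule (Fin n) k d) :
    f ∈ socLift k n I d ↔ ∀ t ∈ contractPerp k n I (d + 1), pairing k n t f = 0 := by
  rw [mem_socLift_iff, and_iff_right hf]
  constructor
  · intro h t ht
    have hℓf : ∀ ℓ ∈ homogeneousSubmodule (Fin n) k 1, ℓ * f ∈ I := by
      intro ℓ hℓ
      rw [homogeneousSubmodule_one_eq_span_X] at hℓ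
      induction hℓ using Submodule.span_induction with
      | mem x hx => obtain ⟨i, rfl⟩ := hx; exact h i
      | zero => simp
      | add x y _ _ hx hy => rw [add_mul]; exact I.add_mem hx hy
      | smul c x _ hx => rw [smul_mul_assoc]; exact (I.restrictScalars k).smul_mem c hx
    induction ht using Submodule.span_induction with
    | mem x hx =>
      obtain ⟨ℓ, hℓ, G, hG, rfl⟩ := hx
      rw [pairing_comm, ← pairing_mul]
      exact pairing_eq_zero_of_mem_perpSub (hℓf ℓ hℓ) hG
    | zero => simp
    | add x y _ _ hx hy => simp [hx, hy]
    | smul c x _ hx => simp [hx]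
  · intro h i
    have hXf : X i * f ∈ homogeneousSubmodule (Fin n) k (d + 1) :=
      add_comm d 1 ▸ (isHomogeneous_X k i).mul hf
    refine (mem_of_orthogonal inf_le_left (mem_perpSub_iff_pairing hI (d + 1)) hXf ?_).2
    intro G hG
    rw [pairing_mul, pairing_comm]
    exact h _ (Submodule.subset_span ⟨X i, isHomogeneous_X k i, G, hG, rfl⟩)

theorem contract_X_ne_zero {e : Fin n →₀ ℕ} {i : Fin n} {G : MvPolynomial (Fin n) k}
    (he : coeff e G ≠ 0) (hi : e i ≠ 0) : contract k n (X i) G ≠ 0 := by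
  intro h
  have h1 := coeff_contract (X i) G (e - Finsupp.single i 1)
  have hle : Finsupp.single i 1 ≤ e := by simpa using Nat.one_le_iff_ne_zero.2 hi
  rw [h, coeff_zero, X, monomial_mul, add_tsub_cancel_of_le hle, pairing_monomial, one_mul,
    one_mul] at h1
  exact he h1.symm

theorem finrank_contractPerp_le (d : ℕ) :
    Module.finrank k (contractPerp k n I d) ≤ Module.finrank k (perpSub k n I d) * n := by
  have := finite_of_le_homogeneousSubmodule (perpSub_le (I := I) d)
  let φ : (Fin n → perpSub k n I d) →ₗ[k] MvPolynomial (Fin n) k :=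
    { toFun := fun G => ∑ i, contract k n (X i) (G i)
      map_add' := fun G G' => by simp [contract_add_right, Finset.sum_add_distrib]
      map_smul' := fun c G => by simp [contract_smul_right, Finset.smul_sum] }
  have hle : contractPerp k n I d ≤ LinearMap.range φ := by
    refine Submodule.span_le.2 ?_
    rintro _ ⟨ℓ, hℓ, G, hG, rfl⟩
    rw [homogeneousSubmodule_one_eq_span_X] at hℓ
    induction hℓ using Submodule.span_induction with
    | mem x hx =>
      obtain ⟨i, rfl⟩ := hx
      refine ⟨Pi.single i ⟨G, hG⟩, ?_⟩
      refine (Finset.sum_eq_single_of_mem i (Finset.mem_univ i) fun j _ hj => ?_).trans (by simp)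
      simp [Pi.single_eq_of_ne hj, contract_zero_right]
    | zero => rw [contract_zero_left]; exact Submodule.zero_mem _
    | add x y _ _ hx hy => rw [contract_add_left]; exact Submodule.add_mem _ hx hy
    | smul c x _ hx => rw [contract_smul_left]; exact Submodule.smul_mem _ c hx
  calc Module.finrank k (contractPerp k n I d)
      ≤ Module.finrank k (LinearMap.range φ) := Submodule.finrank_mono hle
    _ ≤ Module.finrank k (Fin n → perpSub k n I d) := LinearMap.finrank_range_le φ
    _ = Module.finrank k (perpSub k n I d) * n := by
      rw [Module.finrank_pi_fintype]; simp [mul_comm]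

end Ideal

variable (k n)

/-- Socle polynomial of a narrow algebra (Lemma `l:narrow`(1)): if `A = R/I` is narrow
with `s(A) = d` and `dim_k (I^⊥)_{-d} = a`, then the socle polynomial is
`b·z^{d-1} + a·z^d` with `b = dim_k R_{d-1} − dim_k (R_1 ∘ (I^⊥)_{-d})`, and
`dim_k R_{d-1} > b ≥ dim_k R_{d-1} − a·n`. -/
theorem stmt8 (d a : ℕ) (hd : 1 ≤ d) (ha : 1 ≤ a)
    (I : Ideal (MvPolynomial (Fin n) k))
    (hnarrow : IsNarrow k n I) (hs : sdeg k n I = d)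
    (hperp : Module.finrank k ↥(perpSub k n I d) = a) :
    socdim k n I d = a ∧
    (∀ j, j ≠ d → j ≠ d - 1 → socdim k n I j = 0) ∧
    socdim k n I (d - 1) +
        Module.finrank k ↥(Submodule.span k
          {g | ∃ ℓ ∈ homogeneousSubmodule (Fin n) k 1,
            ∃ G ∈ perpSub k n I d, g = contract k n ℓ G}) = rdim k n (d - 1) ∧
    socdim k n I (d - 1) < rdim k n (d - 1) ∧
    rdim k n (d - 1) ≤ socdim k n I (d - 1) + a * n := by
  obtain ⟨hI, hart, hst⟩ := hnarrow
  rw [hs] at hst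
  obtain ⟨d, rfl⟩ := Nat.exists_eq_add_of_le' hd
  have htop (m : ℕ) (hm : d + 1 < m) : Agr k n I m = ⊥ :=
    Agr_eq_bot_of_sdeg_lt hI (hs.trans_lt hm)
  have hlow (i : ℕ) (hi : i < d + 1) : Igrade k n I i = ⊥ :=
    Igrade_eq_bot_of_lt_tdeg (hi.trans_le hst)
  have := finite_of_le_homogeneousSubmodule (perpSub_le (I := I) (d + 1))
  obtain ⟨⟨G, hG⟩, hG0⟩ := Module.finrank_pos_iff_exists_ne_zero.1 (ha.trans_eq hperp.symm)
  obtain ⟨e, he⟩ := ne_zero_iff.1 (fun h => hG0 (Subtype.ext h) : G ≠ 0)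
  obtain ⟨i, hi⟩ : ∃ i, e i ≠ 0 := by
    by_contra! h
    have hdeg := not_imp_comm.1 (IsHomogeneous.coeff_eq_zero (perpSub_le _ hG)) he
    rw [show e = 0 from Finsupp.ext h, map_zero] at hdeg
    exact absurd hdeg d.succ_ne_zero.symm
  have hsum : socdim k n I d + Module.finrank k (contractPerp k n I (d + 1)) = rdim k n d := by
    rw [socdim_eq_finrank_socLift (hlow d d.lt_succ_self)]
    exact finrank_add_finrank_of_orthogonal (contractPerp_le d) inf_le_left
      (mem_socLift_iff_pairing hI d)
  have hpos : 0 < Module.finrank k (contractPerp k n I (d + 1)) := by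
    have := finite_of_le_homogeneousSubmodule (contractPerp_le (I := I) d)
    refine Module.finrank_pos_iff_exists_ne_zero.2 ⟨⟨contract k n (X i) G,
      Submodule.subset_span ⟨X i, isHomogeneous_X k i, G, hG, rfl⟩⟩, fun h => ?_⟩
    exact contract_X_ne_zero he hi (congrArg Subtype.val h)
  have hle := hperp ▸ finrank_contractPerp_le (I := I) (d + 1)
  rw [Nat.add_sub_cancel]
  refine ⟨?_, fun j hj hj' => ?_, hsum, by lia, by lia⟩
  · rw [socdim, inf_eq_left.2 (Agr_le_socSub (htop _ (d + 1).lt_succ_self)),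
      finrank_Agr_eq_finrank_perpSub hI, hperp]
  · rcases lt_or_ge (d + 1) j with h | h
    · rw [socdim, htop j h, bot_inf_eq, finrank_bot]
    · have hbot : socLift k n I j = ⊥ := by
        refine (Submodule.eq_bot_iff _).2 fun f hf => ?_
        obtain ⟨hf, hf'⟩ := mem_socLift_iff.1 hf
        have hXf : X i * f ∈ Igrade k n I (1 + j) :=
          ⟨(isHomogeneous_X k i).mul hf, hf' i⟩
        rw [hlow (1 + j) (by lia), Submodule.mem_bot] at hXf
        exact (mul_eq_zero.1 hXf).resolve_left (X_ne_zero i)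
      rw [socdim_eq_finrank_socLift (hlow j (by lia)), hbot, finrank_bot]

end PSI
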